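/- arXiv:2411.02821 — 2 statements merged into one kernel-verified Lean document; each statement's English description precedes it below -/
import Mathlib

section
/- Let T be an M-consistent bipartite tournament for some M ⊆ V(T), let (X_1, X_2, …, X_i, X_{i+1}, …) be the canonical sequence of T[M], and let v ∈ V(T) \ M be an (M,X_i)-conflicting vertex. Then the canonical sequence of T[M ∪ {v}] is (X_1, …, X_{i−1}, X_i', {v}, X_i'', X_{i+1}, …), where X_i' and X_i'' are nonempty sets with X_i' ∪ X_i'' = X_i. -/
open Set

variable {V : Type*}

/-- The arc relation `E` restricted to the vertex set `S` has no directed cycle. -/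
def AcyclicOn (E : V → V → Prop) (S : Set V) : Prop :=
  ∀ v : V, ¬ Relation.TransGen (fun x y => x ∈ S ∧ y ∈ S ∧ E x y) v v

/-- `E` is a bipartite tournament with partite sets `A` and `B`. -/
def IsBipartiteTournament (E : V → V → Prop) (A B : Set V) : Prop :=
  A ∪ B = Set.univ ∧ A ∩ B = ∅ ∧
  (∀ a ∈ A, ∀ b ∈ B, Xor' (E a b) (E b a)) ∧
  (∀ u ∈ A, ∀ v ∈ A, ¬ E u v) ∧
  (∀ u ∈ B, ∀ v ∈ B, ¬ E u v)

/-- `H` is a feedback vertex set: deleting `H` leaves an acyclic digraph. -/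
def IsFVS (E : V → V → Prop) (H : Set V) : Prop := AcyclicOn E Hᶜ

/-- A directed cycle of length 4 (a square) on the distinct vertices `a b c d`. -/
def IsDirSquare (E : V → V → Prop) (a b c d : V) : Prop :=
  a ≠ b ∧ a ≠ c ∧ a ≠ d ∧ b ≠ c ∧ b ≠ d ∧ c ≠ d ∧
  E a b ∧ E b c ∧ E c d ∧ E d a

/-- Out-neighborhood. -/
def OutN (E : V → V → Prop) (v : V) : Set V := {u | E v u}

/-- In-neighborhood. -/
def InN (E : V → V → Prop) (v : V) : Set V := {u | E u v}

/-- The union `X 1 ∪ ⋯ ∪ X (i-1)` of the sets preceding index `i` (1-based). -/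
def SeqPrev (X : ℕ → Set V) (i : ℕ) : Set V := {v | ∃ j, 1 ≤ j ∧ j < i ∧ v ∈ X j}

/-- `X 1, …, X l` is the canonical sequence of the digraph induced by `E` on `S`:
`X i` is the set of vertices with no incoming arc in the graph induced on
`S \ (X 1 ∪ ⋯ ∪ X (i-1))`, `l` is minimal with `X 1 ∪ ⋯ ∪ X l = S`, and
`X` is `∅` outside the indices `1, …, l`. -/
def IsCanonicalSeq (E : V → V → Prop) (S : Set V) (l : ℕ) (X : ℕ → Set V) : Prop :=
  (∀ i, 1 ≤ i → i ≤ l →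
    X i = {v | v ∈ S ∧ v ∉ SeqPrev X i ∧ ∀ u ∈ S, u ∉ SeqPrev X i → ¬ E u v}) ∧
  SeqPrev X (l + 1) = S ∧
  (∀ l', l' < l → SeqPrev X (l' + 1) ≠ S) ∧
  (∀ i, i = 0 ∨ l < i → X i = ∅)

/-- The digraph induced on `S` is `M`-consistent: for every `v ∈ S` the induced
subgraph on `M ∪ {v}` is acyclic. -/
def MConsistentOn (E : V → V → Prop) (S M : Set V) : Prop :=
  ∀ v ∈ S, AcyclicOn E (M ∪ {v})

/-- `u` and `v` are `M`-equivalent. -/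
def MEquiv (E : V → V → Prop) (M : Set V) (u v : V) : Prop :=
  OutN E u ∩ M = OutN E v ∩ M ∧ InN E u ∩ M = InN E v ∩ M

/-- `v` is `(M, X i)`-equivalent: `v` is `M`-equivalent to a vertex of `X i`. -/
def MXEquiv (E : V → V → Prop) (M : Set V) (X : ℕ → Set V) (i : ℕ) (v : V) : Prop :=
  ∃ u ∈ X i, MEquiv E M v u

/-- `v` is `(M, X i)`-conflicting. -/
def MXConflict (E : V → V → Prop) (X : ℕ → Set V) (i : ℕ) (v : V) : Prop :=
  (OutN E v ∩ X i).Nonempty ∧ (InN E v ∩ X i).Nonempty ∧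
  (∀ j, j < i → OutN E v ∩ X j = ∅) ∧
  (∀ j, i < j → InN E v ∩ X j = ∅)

/-- `π` is a topological sort of the digraph induced by `E` on `S`. -/
def IsTopSortOn (E : V → V → Prop) (S : Set V) (π : V → ℕ) : Prop :=
  Set.InjOn π S ∧ ∀ u ∈ S, ∀ w ∈ S, E u w → π u < π w

/-- `v` is `M⁻`-universal (w.r.t. the canonical sequence `X` of `T[M]`). -/
def MUnivMinus (E : V → V → Prop) (M : Set V) (X : ℕ → Set V) (v : V) : Prop :=
  (∀ i, ¬ MXEquiv E M X i v) ∧ AcyclicOn E (M ∪ {v}) ∧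
  ∃ π : V → ℕ, IsTopSortOn E (M ∪ {v}) π ∧ ∀ u ∈ M ∪ {v}, u ≠ v → π v < π u

/-- `v` is `M⁺`-universal (w.r.t. the canonical sequence `X` of `T[M]`). -/
def MUnivPlus (E : V → V → Prop) (M : Set V) (X : ℕ → Set V) (v : V) : Prop :=
  (∀ i, ¬ MXEquiv E M X i v) ∧ AcyclicOn E (M ∪ {v}) ∧
  ∃ π : V → ℕ, IsTopSortOn E (M ∪ {v}) π ∧ ∀ u ∈ M ∪ {v}, u ≠ v → π u < π v

/-- `v` is `M`-universal. -/
def MUniversal (E : V → V → Prop) (M : Set V) (X : ℕ → Set V) (v : V) : Prop :=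
  MUnivMinus E M X v ∨ MUnivPlus E M X v

/-- `(X 1, Y 1, …, X l, Y l)` is the `M`-sequence of the digraph induced by `E` on
the vertex set `S`, where `X'` is the canonical sequence of `T[M]`:  `X i` is the set
of all `(M, X' i)`-equivalent vertices of `S` and `Y i` the set of all
`(M, X' i)`-conflicting vertices of `S`, with `Y 1` additionally containing every
`M⁻`-universal vertex and `Y l` every `M⁺`-universal vertex of `S`. -/
def IsMSeqOn (E : V → V → Prop) (S M : Set V) (l : ℕ) (X' X Y : ℕ → Set V) : Prop :=
  IsCanonicalSeq E M l X' ∧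
  (∀ i, 1 ≤ i → i ≤ l → X i = {w | w ∈ S ∧ MXEquiv E M X' i w}) ∧
  (∀ i, 1 ≤ i → i ≤ l → Y i =
    {w | w ∈ S ∧ MXConflict E X' i w} ∪
    (if i = 1 then {w | w ∈ S ∧ MUnivMinus E M X' w} else ∅) ∪
    (if i = l then {w | w ∈ S ∧ MUnivPlus E M X' w} else ∅)) ∧
  (∀ i, i = 0 ∨ l < i → X i = ∅ ∧ Y i = ∅)

/-- Every collection of at least `t` consecutive vertices of `π` restricted to `S`
contains a vertex of `M`. -/
def ConsecHitsOn (π : V → ℕ) (S M : Set V) (t : ℝ) : Prop :=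
  ∀ u ∈ S, ∀ w ∈ S, π u ≤ π w →
    t ≤ ({x | x ∈ S ∧ π u ≤ π x ∧ π x ≤ π w}.ncard : ℝ) →
    ∃ m ∈ M ∩ S, π u ≤ π m ∧ π m ≤ π w

/-- A feedback vertex set `H` is `M`-homogeneous: some topological sort `π` of
`T − H` is such that every `10 (log₂ k)³` consecutive vertices of `π` restricted to
`A \ H`, respectively to `B \ H`, contain a vertex of `M`. -/
def MHomogeneous (E : V → V → Prop) (A B M H : Set V) (k : ℕ) : Prop :=
  ∃ π : V → ℕ, IsTopSortOn E Hᶜ π ∧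
    ConsecHitsOn π (A \ H) M (10 * (Real.logb 2 k) ^ 3) ∧
    ConsecHitsOn π (B \ H) M (10 * (Real.logb 2 k) ^ 3)

/-- The left boundary of block `i`: vertices of `X i` occurring before the first
`M`-vertex of `X i` in the topological sort `π`. -/
def LeftBd (π : V → ℕ) (X : ℕ → Set V) (M : Set V) (i : ℕ) : Set V :=
  {x | x ∈ X i ∧ ∀ m ∈ X i ∩ M, π x < π m}

/-- The right boundary of block `i`: vertices of `X i` occurring after the last
`M`-vertex of `X i` in the topological sort `π`. -/
def RightBd (π : V → ℕ) (X : ℕ → Set V) (M : Set V) (i : ℕ) : Set V :=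
  {x | x ∈ X i ∧ ∀ m ∈ X i ∩ M, π m < π x}

/-- The vicinity of block `i`. -/
def Vicinity (π : V → ℕ) (X Y : ℕ → Set V) (M : Set V) (i : ℕ) : Set V :=
  LeftBd π X M i ∪ RightBd π X M i ∪ Y i ∪ RightBd π X M (i - 1) ∪ LeftBd π X M (i + 1)

/-- `F` is a `t`-wise independent family of functions from `V` to `{1, …, q}`. -/
def TwiseIndep (F : Finset (V → ℕ)) (t q : ℕ) : Prop :=
  F.Nonempty ∧
  (∀ f ∈ F, ∀ v : V, f v ∈ Finset.Icc 1 q) ∧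
  ∀ g : Fin t → V, Function.Injective g →
    ∀ α : Fin t → ℕ, (∀ i, α i ∈ Finset.Icc 1 q) →
      (F.filter fun f => ∀ i, f (g i) = α i).card * q ^ t = F.card

/-- `u` and `v` are false twins. -/
def FalseTwins (E : V → V → Prop) (u v : V) : Prop :=
  ¬ E u v ∧ ¬ E v u ∧ OutN E u = OutN E v ∧ InN E u = InN E v

/-- The vertex set of a quadruple (used for vertex sets of squares). -/
def quadVerts (q : V × V × V × V) : Set V := {q.1, q.2.1, q.2.2.1, q.2.2.2}

theorem mem_seqPrev_of_mem {X : ℕ → Set V} {j k : ℕ} {x : V} (hj : 1 ≤ j) (hjk : j < k)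
    (hx : x ∈ X j) : x ∈ SeqPrev X k :=
  ⟨j, hj, hjk, hx⟩

/-- The layers of a canonical sequence are nonempty only at indices `1, …, l`. -/
theorem IsCanonicalSeq.index_mem {E : V → V → Prop} {S : Set V} {l : ℕ} {X : ℕ → Set V}
    (h : IsCanonicalSeq E S l X) {j : ℕ} {x : V} (hx : x ∈ X j) : 1 ≤ j ∧ j ≤ l := by
  by_contra hj
  rw [h.2.2.2 j (by omega)] at hx
  exact hx

theorem IsCanonicalSeq.mem_layer {E : V → V → Prop} {S : Set V} {l : ℕ} {X : ℕ → Set V}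
    (h : IsCanonicalSeq E S l X) {j : ℕ} {x : V} (hx : x ∈ X j) :
    x ∈ S ∧ x ∉ SeqPrev X j ∧ ∀ u ∈ S, u ∉ SeqPrev X j → ¬ E u x := by
  obtain ⟨h1, hl⟩ := h.index_mem hx
  rw [h.1 j h1 hl] at hx
  exact hx

theorem IsCanonicalSeq.exists_mem_layer {E : V → V → Prop} {S : Set V} {l : ℕ} {X : ℕ → Set V}
    (h : IsCanonicalSeq E S l X) {x : V} (hx : x ∈ S) : ∃ j, x ∈ X j := by
  rw [← h.2.1] at hx
  obtain ⟨j, -, -, hj⟩ := hx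
  exact ⟨j, hj⟩

theorem IsCanonicalSeq.index_unique {E : V → V → Prop} {S : Set V} {l : ℕ} {X : ℕ → Set V}
    (h : IsCanonicalSeq E S l X) {j k : ℕ} {x : V} (hj : x ∈ X j) (hk : x ∈ X k) : j = k := by
  rcases lt_trichotomy j k with hlt | heq | hlt
  · exact absurd (mem_seqPrev_of_mem (h.index_mem hj).1 hlt hj) (h.mem_layer hk).2.1
  · exact heq
  · exact absurd (mem_seqPrev_of_mem (h.index_mem hk).1 hlt hk) (h.mem_layer hj).2.1

/-- Arcs go forward along a canonical sequence. -/
theorem IsCanonicalSeq.index_lt_of_arc {E : V → V → Prop} {S : Set V} {l : ℕ} {X : ℕ → Set V}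
    (h : IsCanonicalSeq E S l X) {j k : ℕ} {x y : V} (hx : x ∈ X j) (hy : y ∈ X k)
    (hxy : E x y) : j < k := by
  by_contra hjk
  refine (h.mem_layer hy).2.2 x (h.mem_layer hx).1 ?_ hxy
  rintro ⟨m, -, hm, hxm⟩
  have := h.index_unique hx hxm
  omega

/-- Every vertex of a layer other than the first has an in-neighbor in the preceding layer. -/
theorem IsCanonicalSeq.exists_arc_from_prev {E : V → V → Prop} {S : Set V} {l : ℕ}
    {X : ℕ → Set V} (h : IsCanonicalSeq E S l X) {k : ℕ} {y : V} (hk : 1 ≤ k)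
    (hy : y ∈ X (k + 1)) : ∃ x ∈ X k, E x y := by
  have hkl := (h.index_mem hy).2
  obtain ⟨hyS, hyp, hya⟩ := h.mem_layer hy
  have hyk : y ∉ X k := fun hyk => hyp (mem_seqPrev_of_mem hk (Nat.lt_succ_self k) hyk)
  rw [h.1 k hk (by omega)] at hyk
  have hypk : y ∉ SeqPrev X k := by
    rintro ⟨m, hm, hmk, hym⟩
    exact hyp ⟨m, hm, by omega, hym⟩
  simp only [Set.mem_ofPred_eq, not_and, not_forall, not_not] at hyk
  obtain ⟨u, huS, hup, huy⟩ := hyk hyS hypk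
  have hupk : u ∈ SeqPrev X (k + 1) := by
    by_contra hn
    exact hya u huS hn huy
  obtain ⟨m, hm, hmk, hum⟩ := hupk
  have hmk' : m = k := by
    by_contra hne
    exact hup ⟨m, hm, by omega, hum⟩
  exact ⟨u, hmk' ▸ hum, huy⟩

theorem IsCanonicalSeq.last_nonempty {E : V → V → Prop} {S : Set V} {l : ℕ} {X : ℕ → Set V}
    (h : IsCanonicalSeq E S l X) (hl : 1 ≤ l) : (X l).Nonempty := by
  by_contra hne
  refine h.2.2.1 (l - 1) (by omega) ?_
  refine Eq.trans (Set.ext fun x => ⟨?_, ?_⟩) h.2.1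
  · rintro ⟨j, h1, hj, hx⟩
    exact ⟨j, h1, by omega, hx⟩
  · rintro ⟨j, h1, hj, hx⟩
    have hjl : j ≠ l := by
      rintro rfl
      exact hne ⟨x, hx⟩
    exact ⟨j, h1, by omega, hx⟩

/-- A sequence of disjoint layers covering `S`, along which arcs go forward and in which every
vertex has an in-neighbor in the preceding layer, is the canonical sequence. -/
theorem IsCanonicalSeq.of_layers {E : V → V → Prop} {S : Set V} {l : ℕ} {X : ℕ → Set V}
    (hmem : ∀ x, x ∈ S ↔ ∃ j, x ∈ X j)
    (hindex : ∀ j x, x ∈ X j → 1 ≤ j ∧ j ≤ l)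
    (hunique : ∀ j k x, x ∈ X j → x ∈ X k → j = k)
    (harc : ∀ j k x y, x ∈ X j → y ∈ X k → E x y → j < k)
    (hprev : ∀ k y, 1 ≤ k → y ∈ X (k + 1) → ∃ x ∈ X k, E x y)
    (hlast : (X l).Nonempty) : IsCanonicalSeq E S l X := by
  refine ⟨fun i hi _ => Set.ext fun w => ⟨fun hw => ⟨(hmem w).2 ⟨i, hw⟩, ?_, ?_⟩, ?_⟩,
    Set.ext fun x => ⟨?_, ?_⟩, ?_, ?_⟩
  · rintro ⟨m, -, hm, hwm⟩
    have := hunique _ _ _ hw hwm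
    omega
  · intro u huS hup huw
    obtain ⟨k, huk⟩ := (hmem u).1 huS
    exact hup ⟨k, (hindex k u huk).1, harc _ _ _ _ huk hw huw, huk⟩
  · rintro ⟨hwS, hwp, hwa⟩
    obtain ⟨k, hwk⟩ := (hmem w).1 hwS
    have hk := hindex k w hwk
    have hik : i ≤ k := by
      by_contra hlt
      exact hwp ⟨k, hk.1, by omega, hwk⟩
    rcases hik.eq_or_lt with rfl | hlt
    · exact hwk
    · obtain ⟨k, rfl⟩ : ∃ m, k = m + 1 := ⟨k - 1, by omega⟩
      obtain ⟨u, huk, huw⟩ := hprev k w (by omega) hwk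
      refine absurd huw (hwa u ((hmem u).2 ⟨k, huk⟩) ?_)
      rintro ⟨m, -, hm, hum⟩
      have := hunique _ _ _ huk hum
      omega
  · rintro ⟨j, -, -, hx⟩
    exact (hmem x).2 ⟨j, hx⟩
  · intro hx
    obtain ⟨j, hj⟩ := (hmem x).1 hx
    have := hindex j x hj
    exact ⟨j, this.1, by omega, hj⟩
  · intro l' hl' heq
    obtain ⟨x, hx⟩ := hlast
    have hxS : x ∈ S := (hmem x).2 ⟨l, hx⟩
    rw [← heq] at hxS
    obtain ⟨j, -, hj, hxj⟩ := hxS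
    have := hunique _ _ _ hx hxj
    omega
  · intro i hi
    refine Set.eq_empty_of_forall_notMem fun x hx => ?_
    have := hindex i x hx
    omega

theorem IsBipartiteTournament.asymm {E : V → V → Prop} {A B : Set V}
    (h : IsBipartiteTournament E A B) {x y : V} (hxy : E x y) : ¬ E y x := by
  obtain ⟨hU, -, hX, hA, hB⟩ := h
  have hx : x ∈ A ∪ B := hU ▸ Set.mem_univ x
  have hy : y ∈ A ∪ B := hU ▸ Set.mem_univ y
  have hX : ∀ a ∈ A, ∀ b ∈ B, (E a b ∧ ¬ E b a) ∨ (E b a ∧ ¬ E a b) := hX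
  simp only [Set.mem_union] at hx hy
  grind

/-- Nonadjacent vertices of a bipartite tournament have the same neighbors. -/
theorem IsBipartiteTournament.adj_of_not_adj {E : V → V → Prop} {A B : Set V}
    (h : IsBipartiteTournament E A B) {x y z : V} (hxy : ¬ E x y) (hyx : ¬ E y x)
    (hyz : E y z ∨ E z y) : E x z ∨ E z x := by
  obtain ⟨hU, -, hX, hA, hB⟩ := h
  have hx : x ∈ A ∪ B := hU ▸ Set.mem_univ x
  have hy : y ∈ A ∪ B := hU ▸ Set.mem_univ y
  have hz : z ∈ A ∪ B := hU ▸ Set.mem_univ z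
  have hX : ∀ a ∈ A, ∀ b ∈ B, (E a b ∧ ¬ E b a) ∨ (E b a ∧ ¬ E a b) := hX
  simp only [Set.mem_union] at hx hy hz
  grind

theorem stmt_5 [Fintype V] (E : V → V → Prop) (A B : Set V)
    (hT : IsBipartiteTournament E A B) (M : Set V)
    (hcons : MConsistentOn E Set.univ M)
    (l : ℕ) (X' : ℕ → Set V) (hX : IsCanonicalSeq E M l X')
    (v : V) (hv : v ∉ M) (i : ℕ) (hi1 : 1 ≤ i) (hil : i ≤ l)
    (hconf : MXConflict E X' i v) :
    ∃ X₁ X₂ : Set V, X₁.Nonempty ∧ X₂.Nonempty ∧ X₁ ∪ X₂ = X' i ∧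
      IsCanonicalSeq E (M ∪ {v}) (l + 2)
        (fun j => if j < i then X' j else if j = i then X₁
          else if j = i + 1 then {v} else if j = i + 2 then X₂ else X' (j - 2)) := by
  obtain ⟨⟨p, hvp, hp⟩, ⟨q, hqv, hq⟩, hout, hin⟩ := hconf
  have hvp : E v p := hvp
  have hqv : E q v := hqv
  have hasymm : ∀ x y, E x y → ¬ E y x := fun x y => hT.asymm
  have hunique : ∀ j k x, x ∈ X' j → x ∈ X' k → j = k := fun _ _ _ => hX.index_unique
  have harc : ∀ j k x y, x ∈ X' j → y ∈ X' k → E x y → j < k :=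
    fun _ _ _ _ => hX.index_lt_of_arc
  have hvX : ∀ j, v ∉ X' j := fun j hj => hv (hX.mem_layer hj).1
  have hindex : ∀ j x, x ∈ X' j → 1 ≤ j ∧ j ≤ l := fun _ _ => hX.index_mem
  have hadj : ∀ j x y z, x ∈ X' j → y ∈ X' j → E y z ∨ E z y → E x z ∨ E z x := by
    intro j x y z hx hy
    exact hT.adj_of_not_adj (fun h => (harc _ _ _ _ hx hy h).false)
      (fun h => (harc _ _ _ _ hy hx h).false)
  have hadjv : ∀ x ∈ X' i, E x v ∨ E v x := fun x hx => hadj i x p v hx hp (Or.inr hvp)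
  have hout' : ∀ j x, x ∈ X' j → E v x → i ≤ j := by
    intro j x hx hvx
    by_contra hlt
    exact (hout j (by omega)).subset ⟨hvx, hx⟩
  have hin' : ∀ j x, x ∈ X' j → E x v → j ≤ i := by
    intro j x hx hxv
    by_contra hlt
    exact (hin j (by omega)).subset ⟨hxv, hx⟩
  refine ⟨InN E v ∩ X' i, OutN E v ∩ X' i, ⟨q, hqv, hq⟩, ⟨p, hvp, hp⟩, ?_, ?_⟩
  · ext x
    exact ⟨fun h => h.elim And.right And.right,
      fun hx => (hadjv x hx).imp (fun h => ⟨h, hx⟩) (fun h => ⟨h, hx⟩)⟩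
  generalize hY : (fun j => if j < i then X' j else if j = i then InN E v ∩ X' i
    else if j = i + 1 then {v} else if j = i + 2 then OutN E v ∩ X' i else X' (j - 2)) = Y
  have hYmem : ∀ j x, x ∈ Y j ↔ (j < i ∧ x ∈ X' j) ∨ (j = i ∧ E x v ∧ x ∈ X' i) ∨
      (j = i + 1 ∧ x = v) ∨ (j = i + 2 ∧ E v x ∧ x ∈ X' i) ∨
      (i + 2 < j ∧ x ∈ X' (j - 2)) := by
    intro j x
    rw [← hY]
    dsimp only
    have hI : x ∈ InN E v ∩ X' i ↔ E x v ∧ x ∈ X' i := Iff.rfl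
    have hO : x ∈ OutN E v ∩ X' i ↔ E v x ∧ x ∈ X' i := Iff.rfl
    have hS : x ∈ ({v} : Set V) ↔ x = v := Iff.rfl
    split_ifs <;> grind
  apply IsCanonicalSeq.of_layers
  · intro x
    constructor
    · rintro (hx | rfl)
      · obtain ⟨j, hj⟩ := hX.exists_mem_layer hx
        rcases lt_trichotomy j i with h | rfl | h
        · exact ⟨j, (hYmem _ _).2 (Or.inl ⟨h, hj⟩)⟩
        · rcases hadjv x hj with h | h
          · exact ⟨j, (hYmem _ _).2 (by tauto)⟩
          · exact ⟨j + 2, (hYmem _ _).2 (by tauto)⟩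
        · exact ⟨j + 2, (hYmem _ _).2 (by simp [h, hj])⟩
      · exact ⟨i + 1, (hYmem _ _).2 (by tauto)⟩
    · rintro ⟨j, hj⟩
      rcases (hYmem _ _).1 hj with h | h | h | h | h
      · exact Or.inl (hX.mem_layer h.2).1
      · exact Or.inl (hX.mem_layer h.2.2).1
      · exact Or.inr h.2
      · exact Or.inl (hX.mem_layer h.2.2).1
      · exact Or.inl (hX.mem_layer h.2).1
  · intro j x hx
    rw [hYmem] at hx
    grind
  · intro j k x hj hk
    rw [hYmem] at hj hk
    grind
  · intro j k x y hj hk hxy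
    rw [hYmem] at hj hk
    grind
  · intro k y hk hy
    rw [hYmem] at hy
    rcases hy with ⟨hki, hy⟩ | ⟨hki, -, hy⟩ | ⟨hki, rfl⟩ | ⟨hki, hvy, hy⟩ | ⟨hki, hy⟩
    · obtain ⟨x, hx, hxy⟩ := hX.exists_arc_from_prev hk hy
      exact ⟨x, (hYmem _ _).2 (Or.inl ⟨by omega, hx⟩), hxy⟩
    · obtain ⟨x, hx, hxy⟩ := hX.exists_arc_from_prev hk (hki ▸ hy)
      exact ⟨x, (hYmem _ _).2 (Or.inl ⟨by omega, hx⟩), hxy⟩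
    · obtain rfl : k = i := by omega
      exact ⟨q, (hYmem _ _).2 (by tauto), hqv⟩
    · exact ⟨v, (hYmem _ _).2 (Or.inr (Or.inr (Or.inl ⟨by omega, rfl⟩))), hvy⟩
    · obtain ⟨m, rfl⟩ : ∃ m, k = m + 2 := ⟨k - 2, by omega⟩
      have hy : y ∈ X' (m + 1) := hy
      obtain ⟨x, hx, hxy⟩ := hX.exists_arc_from_prev (by omega) hy
      rcases (show i ≤ m by omega).eq_or_lt with rfl | him
      · refine ⟨p, (hYmem _ _).2 (by tauto), ?_⟩
        refine (hadj i p x y hp hx (Or.inl hxy)).resolve_right fun hyp => ?_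
        have := harc _ _ _ _ hy hp hyp
        omega
      · exact ⟨x, (hYmem _ _).2 (by simp [him, hx]), hxy⟩
  · rcases hil.eq_or_lt with rfl | hlt
    · exact ⟨p, (hYmem _ _).2 (by tauto)⟩
    · obtain ⟨x, hx⟩ := hX.last_nonempty (by omega)
      exact ⟨x, (hYmem _ _).2 (by simp [hlt, hx])⟩
end

section
/- Let T be an M-consistent bipartite tournament with partite sets A and B, let (X_1', X_2', …, X_l') be the canonical sequence of T[M], and let (X_1, Y_1, X_2, Y_2, …, X_l, Y_l) be the M-sequence of T, where X_1' ⊆ A. Then: (i) the sets X_1, Y_1, X_2, Y_2, …, X_l, Y_l form a partition of V(T); (ii) for each i, X_i' ⊆ X_i; (iii) for each i, Y_i ∩ M = ∅; (iv) for every odd i, X_i ⊆ A and Y_i ⊆ B, and for every even i, X_i ⊆ B and Y_i ⊆ A. -/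
open Set

variable {V : Type*}

/-- `X 1, …, X l` are layers of `M`, alternating with respect to the 2-colouring `c` of the
bipartite tournament `E`, such that every arc inside `M` goes from a layer to a later one. -/
structure IsLayering (E : V → V → Prop) (c : V → ℕ) (M : Set V) (l : ℕ)
    (X : ℕ → Set V) : Prop where
  color_lt : ∀ v, c v < 2
  color_ne : ∀ {u v}, E u v → c u ≠ c v
  arc_or : ∀ {u v}, c u ≠ c v → E u v ∨ E v u
  asymm : ∀ {u v}, E u v → ¬ E v u
  mem_range : ∀ {j m}, m ∈ X j → 1 ≤ j ∧ j ≤ l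
  mem_of_layer : ∀ {j m}, m ∈ X j → m ∈ M
  exists_layer : ∀ {m}, m ∈ M → ∃ j, m ∈ X j
  nonempty : ∀ j, 1 ≤ j → j ≤ l → (X j).Nonempty
  lt_of_arc : ∀ {i j u w}, u ∈ X i → w ∈ X j → E u w → i < j
  color : ∀ {j m}, m ∈ X j → c m = j % 2
  index_unique : ∀ {i j m}, m ∈ X i → m ∈ X j → i = j

namespace IsCanonicalSeq

variable {E : V → V → Prop} {M : Set V} {l : ℕ} {X : ℕ → Set V}

theorem mem_range (h : IsCanonicalSeq E M l X) {j : ℕ} {m : V} (hm : m ∈ X j) :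
    1 ≤ j ∧ j ≤ l := by
  by_contra hj
  have := h.2.2.2 j (by omega)
  simp [this] at hm

theorem mem_layer_s8 (h : IsCanonicalSeq E M l X) {j : ℕ} {m : V} (hm : m ∈ X j) :
    m ∈ M ∧ m ∉ SeqPrev X j ∧ ∀ u ∈ M, u ∉ SeqPrev X j → ¬ E u m := by
  have hj := h.mem_range hm
  rw [h.1 j hj.1 hj.2] at hm
  exact hm

theorem exists_layer (h : IsCanonicalSeq E M l X) {m : V} (hm : m ∈ M) : ∃ j, m ∈ X j := by
  rw [← h.2.1] at hm
  obtain ⟨j, -, -, hj⟩ := hm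
  exact ⟨j, hj⟩

theorem index_unique_s8 (h : IsCanonicalSeq E M l X) {i j : ℕ} {m : V} (hi : m ∈ X i)
    (hj : m ∈ X j) : i = j := by
  rcases lt_trichotomy i j with hij | hij | hij
  · exact absurd ⟨i, (h.mem_range hi).1, hij, hi⟩ (h.mem_layer_s8 hj).2.1
  · exact hij
  · exact absurd ⟨j, (h.mem_range hj).1, hij, hj⟩ (h.mem_layer_s8 hi).2.1

theorem lt_of_arc (h : IsCanonicalSeq E M l X) {i j : ℕ} {u w : V} (hu : u ∈ X i)
    (hw : w ∈ X j) (huw : E u w) : i < j := by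
  by_contra hij
  refine (h.mem_layer_s8 hw).2.2 u (h.mem_layer_s8 hu).1 ?_ huw
  rintro ⟨k, -, hkj, hk⟩
  have := h.index_unique_s8 hu hk
  omega

theorem nonempty (h : IsCanonicalSeq E M l X) (i : ℕ) (hi : 1 ≤ i) (hil : i ≤ l) :
    (X i).Nonempty := by
  by_contra hne
  rw [Set.not_nonempty_iff_eq_empty] at hne
  have key : ∀ d, i + d ≤ l + 1 → SeqPrev X (i + d) = SeqPrev X i := by
    intro d
    induction d with
    | zero => intro _; rfl
    | succ d ih =>
      intro hd
      have ih' := ih (by omega)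
      have hX : X (i + d) = ∅ := by
        rw [h.1 (i + d) (by omega) (by omega), ih', ← h.1 i hi hil, hne]
      rw [← ih']
      ext v
      constructor
      · rintro ⟨j, hj1, hj2, hj⟩
        refine ⟨j, hj1, ?_, hj⟩
        have : j ≠ i + d := by
          rintro rfl
          simp [hX] at hj
        omega
      · rintro ⟨j, hj1, hj2, hj⟩
        exact ⟨j, hj1, by omega, hj⟩
  have h1 := key (l + 1 - i) (by omega)
  rw [show i + (l + 1 - i) = l + 1 by omega, h.2.1] at h1
  exact h.2.2.1 (i - 1) (by omega) (by rw [show i - 1 + 1 = i by omega, h1])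

theorem exists_arc_to_succ (h : IsCanonicalSeq E M l X) {i : ℕ} (hi : 1 ≤ i) {w : V}
    (hw : w ∈ X (i + 1)) : ∃ u ∈ X i, E u w := by
  have hr := h.mem_range hw
  have hwi : w ∉ X i := fun hw' => by
    have := h.index_unique_s8 hw hw'
    omega
  have hw' := h.mem_layer_s8 hw
  rw [h.1 i hi (by omega)] at hwi
  have hprev : w ∉ SeqPrev X i := by
    rintro ⟨j, hj1, hj2, hj⟩
    exact hw'.2.1 ⟨j, hj1, by omega, hj⟩
  have : ∃ u ∈ M, u ∉ SeqPrev X i ∧ E u w := by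
    by_contra! hcon
    exact hwi ⟨hw'.1, hprev, hcon⟩
  obtain ⟨u, huM, hu, huw⟩ := this
  obtain ⟨k, hk⟩ := h.exists_layer huM
  have hki := h.lt_of_arc hk hw huw
  have hik : ¬ k < i := fun hlt => hu ⟨k, (h.mem_range hk).1, hlt, hk⟩
  obtain rfl : k = i := by omega
  exact ⟨u, hk, huw⟩

open Classical in
theorem isLayering (h : IsCanonicalSeq E M l X) {A B : Set V}
    (hT : IsBipartiteTournament E A B) (hXA : X 1 ⊆ A) :
    IsLayering E (fun v => if v ∈ A then 1 else 0) M l X := by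
  obtain ⟨hAB, hdis, hxor, hA, hB⟩ := hT
  have hmem : ∀ v, v ∉ A → v ∈ B := fun v hv => by
    have : v ∈ A ∪ B := by rw [hAB]; trivial
    exact this.resolve_left hv
  have hne : ∀ {u v}, E u v → (if u ∈ A then 1 else 0) ≠ (if v ∈ A then 1 else 0) := by
    intro u v huv
    by_cases hu : u ∈ A <;> by_cases hv : v ∈ A <;> simp only [hu, hv, if_true, if_false]
    · exact absurd huv (hA u hu v hv)
    · decide
    · decide
    · exact absurd huv (hB u (hmem u hu) v (hmem v hv))
  have hcol : ∀ j m, m ∈ X (j + 1) → (if m ∈ A then 1 else 0) = (j + 1) % 2 := by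
    intro j
    induction j with
    | zero => intro m hm; simp [hXA hm]
    | succ j ih =>
      intro m hm
      obtain ⟨u, hu, hum⟩ := h.exists_arc_to_succ (by omega) hm
      have h1 := ih u hu
      have h2 := hne hum
      split_ifs at h1 h2 ⊢ <;> omega
  refine ⟨fun v => by split_ifs <;> omega, hne, ?_, ?_, h.mem_range,
    fun hm => (h.mem_layer_s8 hm).1, h.exists_layer, h.nonempty, h.lt_of_arc, ?_, h.index_unique_s8⟩
  · intro u v huv
    by_cases hu : u ∈ A <;> by_cases hv : v ∈ A <;> simp only [hu, hv] at huv
    · simp at huv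
    · exact (hxor u hu v (hmem v hv)).imp And.left And.left
    · exact ((hxor v hv u (hmem u hu)).imp And.left And.left).symm
    · simp at huv
  · intro u v huv hvu
    have h1 := hne huv
    by_cases hu : u ∈ A <;> by_cases hv : v ∈ A <;> simp only [hu, hv] at h1
    · simp at h1
    · rcases hxor u hu v (hmem v hv) with h2 | h2
      exacts [h2.2 hvu, h2.2 huv]
    · rcases hxor v hv u (hmem u hu) with h2 | h2
      exacts [h2.2 huv, h2.2 hvu]
    · simp at h1
  · intro j m hm
    have hj := (h.mem_range hm).1
    obtain ⟨k, rfl⟩ : ∃ k, j = k + 1 := ⟨j - 1, by omega⟩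
    exact hcol k m hm

end IsCanonicalSeq

theorem MEquiv.out_iff {E : V → V → Prop} {M : Set V} {u v m : V} (h : MEquiv E M u v)
    (hm : m ∈ M) : E u m ↔ E v m := by
  have := Set.ext_iff.1 h.1 m
  simpa [OutN, hm] using this

theorem MEquiv.in_iff {E : V → V → Prop} {M : Set V} {u v m : V} (h : MEquiv E M u v)
    (hm : m ∈ M) : E m u ↔ E m v := by
  have := Set.ext_iff.1 h.2 m
  simpa [InN, hm] using this

theorem MXEquiv.of_mem {E : V → V → Prop} {M : Set V} {X : ℕ → Set V} {i : ℕ} {v : V}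
    (hv : v ∈ X i) : MXEquiv E M X i v := ⟨v, hv, rfl, rfl⟩

theorem MXConflict.index_le {E : V → V → Prop} {X : ℕ → Set V} {i j : ℕ} {v : V}
    (hi : MXConflict E X i v) (hj : MXConflict E X j v) : j ≤ i := by
  by_contra! hij
  exact hi.1.ne_empty (hj.2.2.1 i hij)

theorem MUnivMinus.no_in {E : V → V → Prop} {M : Set V} {X : ℕ → Set V} {v m : V}
    (h : MUnivMinus E M X v) (hm : m ∈ M) : ¬ E m v := by
  obtain ⟨-, hac, π, hπ, hfirst⟩ := h
  intro hmv
  have hne : m ≠ v := by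
    rintro rfl
    exact lt_irrefl _ (hπ.2 m (.inl hm) m (.inl hm) hmv)
  exact lt_asymm (hfirst m (.inl hm) hne) (hπ.2 m (.inl hm) v (.inr rfl) hmv)

theorem MUnivPlus.no_out {E : V → V → Prop} {M : Set V} {X : ℕ → Set V} {v m : V}
    (h : MUnivPlus E M X v) (hm : m ∈ M) : ¬ E v m := by
  obtain ⟨-, hac, π, hπ, hlast⟩ := h
  intro hvm
  have hne : m ≠ v := by
    rintro rfl
    exact lt_irrefl _ (hπ.2 m (.inl hm) m (.inl hm) hvm)
  exact lt_asymm (hlast m (.inl hm) hne) (hπ.2 v (.inr rfl) m (.inl hm) hvm)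

namespace IsLayering

variable {E : V → V → Prop} {c : V → ℕ} {M : Set V} {l : ℕ} {X : ℕ → Set V}

theorem arc_of_lt (h : IsLayering E c M l X) {i j : ℕ} {u w : V} (hu : u ∈ X i) (hw : w ∈ X j)
    (hij : i < j) (hc : c u ≠ c w) : E u w :=
  (h.arc_or hc).resolve_right fun hwu => lt_asymm hij (h.lt_of_arc hw hu hwu)

theorem notMem_of_not_mxEquiv (h : IsLayering E c M l X) {v : V}
    (hv : ∀ i, ¬ MXEquiv E M X i v) : v ∉ M := fun hM =>
  let ⟨i, hi⟩ := h.exists_layer hM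
  hv i (MXEquiv.of_mem hi)

theorem color_of_mxEquiv (h : IsLayering E c M l X) {i : ℕ} {v : V} (hv : MXEquiv E M X i v) :
    c v = i % 2 := by
  obtain ⟨u, hu, huv⟩ := hv
  have huM := h.mem_of_layer hu
  by_contra hne
  rw [← h.color hu] at hne
  have : E u u := by
    rcases h.arc_or hne with h1 | h1
    exacts [(huv.out_iff huM).1 h1, (huv.in_iff huM).1 h1]
  exact h.color_ne this rfl

theorem mxEquiv_of (h : IsLayering E c M l X) {i : ℕ} (hi : 1 ≤ i) (hil : i ≤ l) {v : V}
    (hc : c v = i % 2) (hout : ∀ j < i, ∀ m ∈ X j, ¬ E v m)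
    (hin : ∀ j, i < j → ∀ m ∈ X j, ¬ E m v) : MXEquiv E M X i v := by
  obtain ⟨x, hx⟩ := h.nonempty i hi hil
  have hcx := h.color hx
  refine ⟨x, hx, ?_, ?_⟩ <;> ext m <;> simp only [OutN, InN, Set.mem_inter_iff, Set.mem_ofPred_eq]
  · refine and_congr_left fun hm => ?_
    obtain ⟨j, hj⟩ := h.exists_layer hm
    have hcm := h.color hj
    constructor
    · intro hvm
      have h1 := h.color_ne hvm
      have h2 : ¬ j < i := fun hlt => hout j hlt m hj hvm
      have h3 : i ≠ j := by rintro rfl; omega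
      exact h.arc_of_lt hx hj (by omega) (by omega)
    · intro hxm
      have h1 := h.color_ne hxm
      exact (h.arc_or (by omega)).resolve_right (hin j (h.lt_of_arc hx hj hxm) m hj)
  · refine and_congr_left fun hm => ?_
    obtain ⟨j, hj⟩ := h.exists_layer hm
    have hcm := h.color hj
    constructor
    · intro hvm
      have h1 := h.color_ne hvm
      have h2 : ¬ i < j := fun hlt => hin j hlt m hj hvm
      have h3 : i ≠ j := by rintro rfl; omega
      exact h.arc_of_lt hj hx (by omega) (by omega)
    · intro hxm
      have h1 := h.color_ne hxm
      exact (h.arc_or (by omega)).resolve_right (hout j (h.lt_of_arc hj hx hxm) m hj)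

theorem mxEquiv_index_le (h : IsLayering E c M l X) {i j : ℕ} {v : V}
    (hi : MXEquiv E M X i v) (hj : MXEquiv E M X j v) : j ≤ i := by
  by_contra! hij
  have hci := h.color_of_mxEquiv hi
  have hcj := h.color_of_mxEquiv hj
  obtain ⟨u, hu, huv⟩ := hi
  obtain ⟨w, hw, hwv⟩ := hj
  have hjl := h.mem_range hw
  obtain ⟨x, hx⟩ := h.nonempty (i + 1) (by omega) (by omega)
  have hxM := h.mem_of_layer hx
  have h1 := h.color hu
  have h2 := h.color hw
  have h3 := h.color hx
  have hux : E u x := h.arc_of_lt hu hx (by omega) (by omega)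
  have hwx : E w x := (hwv.out_iff hxM).1 ((huv.out_iff hxM).2 hux)
  have := h.lt_of_arc hw hx hwx
  omega

theorem mxEquiv_index_unique (h : IsLayering E c M l X) {i j : ℕ} {v : V}
    (hi : MXEquiv E M X i v) (hj : MXEquiv E M X j v) : i = j :=
  le_antisymm (h.mxEquiv_index_le hj hi) (h.mxEquiv_index_le hi hj)

theorem color_of_mxConflict (h : IsLayering E c M l X) {i : ℕ} {v : V}
    (hv : MXConflict E X i v) : c v ≠ i % 2 := by
  obtain ⟨⟨m, hvm, hm⟩, -⟩ := hv
  rw [← h.color hm]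
  exact h.color_ne hvm

theorem not_mxConflict_of_mxEquiv (h : IsLayering E c M l X) {i j : ℕ} {v : V}
    (hi : MXEquiv E M X i v) : ¬ MXConflict E X j v := by
  rintro ⟨⟨m, hvm, hm⟩, ⟨m', hvm', hm'⟩, -⟩
  obtain ⟨u, hu, huv⟩ := hi
  have h1 := h.lt_of_arc hu hm ((huv.out_iff (h.mem_of_layer hm)).1 hvm)
  have h2 := h.lt_of_arc hm' hu ((huv.in_iff (h.mem_of_layer hm')).1 hvm')
  omega

theorem not_mxConflict_of_mUnivMinus (h : IsLayering E c M l X) {i : ℕ} {v : V}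
    (hv : MUnivMinus E M X v) : ¬ MXConflict E X i v := by
  rintro ⟨-, ⟨m, hmv, hm⟩, -⟩
  exact hv.no_in (h.mem_of_layer hm) hmv

theorem not_mxConflict_of_mUnivPlus (h : IsLayering E c M l X) {i : ℕ} {v : V}
    (hv : MUnivPlus E M X v) : ¬ MXConflict E X i v := by
  rintro ⟨⟨m, hvm, hm⟩, -⟩
  exact hv.no_out (h.mem_of_layer hm) hvm

theorem eq_one_of_mUnivMinus_of_mUnivPlus (h : IsLayering E c M l X) (hl : 1 ≤ l) {v : V}
    (hv : MUnivMinus E M X v) (hv' : MUnivPlus E M X v) : l = 1 := by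
  by_contra hne
  obtain ⟨x, hx⟩ := h.nonempty 1 le_rfl hl
  obtain ⟨y, hy⟩ := h.nonempty 2 (by omega) (by omega)
  have key : ∀ m ∈ M, c v = c m := fun m hm => by
    by_contra hc
    exact (h.arc_or hc).elim (hv'.no_out hm) (hv.no_in hm)
  have h1 := key x (h.mem_of_layer hx)
  have h2 := key y (h.mem_of_layer hy)
  have h3 := h.color hx
  have h4 := h.color hy
  omega

theorem color_of_mUnivMinus (h : IsLayering E c M l X) (hl : 1 ≤ l) {v : V}
    (hv : MUnivMinus E M X v) : c v ≠ 1 % 2 := fun hc =>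
  hv.1 1 (h.mxEquiv_of le_rfl hl hc
    (fun j hj m hm => by have := h.mem_range hm; omega)
    (fun _ _ _ hm => hv.no_in (h.mem_of_layer hm)))

theorem color_of_mUnivPlus (h : IsLayering E c M l X) (hl : 1 ≤ l) {v : V}
    (hv : MUnivPlus E M X v) : c v ≠ l % 2 := fun hc =>
  hv.1 l (h.mxEquiv_of hl le_rfl hc
    (fun _ _ _ hm => hv.no_out (h.mem_of_layer hm))
    (fun j hj m hm => by have := h.mem_range hm; omega))

/-- An in-neighbour of `v` cannot lie in a later layer than an out-neighbour of `v`. -/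
theorem in_le_out (h : IsLayering E c M l X) {v : V} (hac : AcyclicOn E (M ∪ {v})) {j k : ℕ}
    {u w : V} (hu : u ∈ X j) (hvu : E v u) (hw : w ∈ X k) (hwv : E w v) : k ≤ j := by
  by_contra! hjk
  have hj := h.mem_range hu
  have hk := h.mem_range hw
  obtain ⟨x, hx⟩ := h.nonempty (j + 1) (by omega) (by omega)
  have hcu := h.color hu
  have hcw := h.color hw
  have hcx := h.color hx
  have h1 := h.color_ne hvu
  have h2 := h.color_ne hwv
  have h3 := h.color_lt v
  have huM := h.mem_of_layer hu
  have hwM := h.mem_of_layer hw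
  have hxM := h.mem_of_layer hx
  have hux : E u x := h.arc_of_lt hu hx (by omega) (by omega)
  have hxw : E x w := h.arc_of_lt hx hw (by omega) (by omega)
  refine hac v ?_
  exact (((Relation.TransGen.single ⟨.inr rfl, .inl huM, hvu⟩).tail
    ⟨.inl huM, .inl hxM, hux⟩).tail ⟨.inl hxM, .inl hwM, hxw⟩).tail ⟨.inl hwM, .inr rfl, hwv⟩

/-- Numbering the vertices of `M` layer by layer gives a topological sort of `M` by positive
numbers. -/
theorem exists_topSort [Fintype V] (h : IsLayering E c M l X) {v : V} (hvM : v ∉ M) :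
    ∃ a : V → ℕ, IsTopSortOn E M a ∧ ∀ u ∈ M, u ≠ v ∧ 0 < a u := by
  classical
  choose! idx hidx using fun m (hm : m ∈ M) => h.exists_layer hm
  let e := Fintype.equivFin V
  have hlt : ∀ {u w}, idx u < idx w →
      idx u * Fintype.card V + e u < idx w * Fintype.card V + e w := by
    intro u w huw
    have h1 : (idx u + 1) * Fintype.card V ≤ idx w * Fintype.card V :=
      Nat.mul_le_mul_right _ huw
    have h2 := (e u).2
    rw [Nat.succ_mul] at h1
    omega
  refine ⟨fun u => idx u * Fintype.card V + e u, ⟨?_, ?_⟩, ?_⟩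
  · intro u hu w hw huw
    rcases lt_trichotomy (idx u) (idx w) with h1 | h1 | h1
    · exact absurd huw (hlt h1).ne
    · simp only [h1, Nat.add_left_cancel_iff] at huw
      exact e.injective (Fin.ext huw)
    · exact absurd huw (hlt h1).ne'
  · intro u hu w hw huw
    exact hlt (h.lt_of_arc (hidx u hu) (hidx w hw) huw)
  · intro u hu
    refine ⟨by rintro rfl; exact hvM hu, ?_⟩
    have h1 := (h.mem_range (hidx u hu)).1
    have h2 : 0 < Fintype.card V := Fintype.card_pos_iff.2 ⟨v⟩
    have := Nat.mul_pos h1 h2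
    simp only
    omega

theorem mUnivMinus_of [Fintype V] (h : IsLayering E c M l X) {v : V}
    (hv : ∀ i, ¬ MXEquiv E M X i v) (hac : AcyclicOn E (M ∪ {v})) (hin : ∀ m ∈ M, ¬ E m v) :
    MUnivMinus E M X v := by
  classical
  obtain ⟨a, ⟨hinj, hsort⟩, ha⟩ := h.exists_topSort (h.notMem_of_not_mxEquiv hv)
  refine ⟨hv, hac, fun u => if u = v then 0 else a u, ⟨?_, ?_⟩, ?_⟩
  · rintro u (hu | rfl) w (hw | rfl) huw
    · simp only [(ha u hu).1, (ha w hw).1, if_false] at huw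
      exact hinj hu hw huw
    · simp only [(ha u hu).1, if_false, if_true] at huw
      exact absurd huw (ha u hu).2.ne'
    · simp only [(ha w hw).1, if_false, if_true] at huw
      exact absurd huw (ha w hw).2.ne
    · rfl
  · rintro u (hu | rfl) w (hw | rfl) huw
    · simpa only [(ha u hu).1, (ha w hw).1, if_false] using hsort u hu w hw huw
    · exact absurd huw (hin u hu)
    · simpa only [(ha w hw).1, if_false, if_true] using (ha w hw).2
    · exact absurd rfl (h.color_ne huw)
  · rintro u (hu | rfl) hne
    · simpa only [(ha u hu).1, if_false, if_true] using (ha u hu).2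
    · exact absurd rfl hne

theorem mUnivPlus_of [Fintype V] (h : IsLayering E c M l X) {v : V}
    (hv : ∀ i, ¬ MXEquiv E M X i v) (hac : AcyclicOn E (M ∪ {v})) (hout : ∀ m ∈ M, ¬ E v m) :
    MUnivPlus E M X v := by
  classical
  obtain ⟨a, ⟨hinj, hsort⟩, ha⟩ := h.exists_topSort (h.notMem_of_not_mxEquiv hv)
  let s := Finset.univ.sup a + 1
  have hs : ∀ u, a u < s := fun u => Nat.lt_succ_of_le (Finset.le_sup (Finset.mem_univ u))
  refine ⟨hv, hac, fun u => if u = v then s else a u, ⟨?_, ?_⟩, ?_⟩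
  · rintro u (hu | rfl) w (hw | rfl) huw
    · simp only [(ha u hu).1, (ha w hw).1, if_false] at huw
      exact hinj hu hw huw
    · simp only [(ha u hu).1, if_false, if_true] at huw
      exact absurd huw (hs u).ne
    · simp only [(ha w hw).1, if_false, if_true] at huw
      exact absurd huw (hs w).ne'
    · rfl
  · rintro u (hu | rfl) w (hw | rfl) huw
    · simpa only [(ha u hu).1, (ha w hw).1, if_false] using hsort u hu w hw huw
    · simpa only [(ha u hu).1, if_false, if_true] using hs u
    · exact absurd huw (hout w hw)
    · exact absurd rfl (h.color_ne huw)
  · rintro u (hu | rfl) hne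
    · simpa only [(ha u hu).1, if_false, if_true] using hs u
    · exact absurd rfl hne

theorem mxEquiv_or_mUnivMinus [Fintype V] (h : IsLayering E c M l X) (hl : 1 ≤ l) {v : V}
    (hac : AcyclicOn E (M ∪ {v})) (hin : ∀ m ∈ M, ¬ E m v) :
    MXEquiv E M X 1 v ∨ MUnivMinus E M X v := by
  by_cases hc : c v = 1 % 2
  · exact .inl (h.mxEquiv_of le_rfl hl hc
      (fun j hj m hm => by have := h.mem_range hm; omega)
      (fun _ _ m hm => hin m (h.mem_of_layer hm)))
  · refine .inr (h.mUnivMinus_of (fun i hi => ?_) hac hin)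
    have hci := h.color_of_mxEquiv hi
    obtain ⟨u, hu, huv⟩ := hi
    have hi := h.mem_range hu
    obtain ⟨x, hx⟩ := h.nonempty 1 le_rfl hl
    have h1 := h.color hu
    have h2 := h.color hx
    have h3 : i ≠ 1 := by rintro rfl; exact hc hci
    have hxM := h.mem_of_layer hx
    exact hin x hxM ((huv.in_iff hxM).2 (h.arc_of_lt hx hu (by omega) (by omega)))

theorem mxEquiv_or_mUnivPlus [Fintype V] (h : IsLayering E c M l X) (hl : 1 ≤ l) {v : V}
    (hac : AcyclicOn E (M ∪ {v})) (hout : ∀ m ∈ M, ¬ E v m) :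
    MXEquiv E M X l v ∨ MUnivPlus E M X v := by
  by_cases hc : c v = l % 2
  · exact .inl (h.mxEquiv_of hl le_rfl hc
      (fun _ _ m hm => hout m (h.mem_of_layer hm))
      (fun j hj m hm => by have := h.mem_range hm; omega))
  · refine .inr (h.mUnivPlus_of (fun i hi => ?_) hac hout)
    have hci := h.color_of_mxEquiv hi
    obtain ⟨u, hu, huv⟩ := hi
    have hi := h.mem_range hu
    obtain ⟨x, hx⟩ := h.nonempty l hl le_rfl
    have h1 := h.color hu
    have h2 := h.color hx
    have h3 : i ≠ l := by rintro rfl; exact hc hci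
    have hxM := h.mem_of_layer hx
    exact hout x hxM ((huv.out_iff hxM).2 (h.arc_of_lt hu hx (by omega) (by omega)))

theorem exists_mxEquiv_or_mxConflict (h : IsLayering E c M l X) {v : V}
    (hac : AcyclicOn E (M ∪ {v})) (hin : ∃ m ∈ M, E m v) (hout : ∃ m ∈ M, E v m) :
    ∃ i, 1 ≤ i ∧ i ≤ l ∧ (MXEquiv E M X i v ∨ MXConflict E X i v) := by
  classical
  have hex : ∃ j, ∃ m ∈ X j, E v m := by
    obtain ⟨m, hm, hvm⟩ := hout
    obtain ⟨j, hj⟩ := h.exists_layer hm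
    exact ⟨j, m, hj, hvm⟩
  obtain ⟨j, ⟨u, hu, hvu⟩, hmin⟩ : ∃ j, (∃ m ∈ X j, E v m) ∧ ∀ i < j, ∀ m ∈ X i, ¬ E v m :=
    ⟨Nat.find hex, Nat.find_spec hex, fun i hi m hm hvm => Nat.find_min hex hi ⟨m, hm, hvm⟩⟩
  have hj := h.mem_range hu
  by_cases hjin : ∃ m ∈ X j, E m v
  · obtain ⟨w, hw, hwv⟩ := hjin
    refine ⟨j, hj.1, hj.2, .inr ⟨⟨u, hvu, hu⟩, ⟨w, hwv, hw⟩, fun i hi => ?_, fun i hi => ?_⟩⟩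
    · exact Set.eq_empty_of_forall_notMem fun m hm => hmin i hi m hm.2 hm.1
    · refine Set.eq_empty_of_forall_notMem fun m hm => ?_
      have := h.in_le_out hac hu hvu hm.2 hm.1
      omega
  · push Not at hjin
    obtain ⟨w, hwM, hwv⟩ := hin
    obtain ⟨k, hk⟩ := h.exists_layer hwM
    have h1 := h.in_le_out hac hu hvu hk hwv
    have h2 : k ≠ j := by rintro rfl; exact hjin w hk hwv
    have h3 := h.mem_range hk
    have h4 := h.color_ne hvu
    have h5 := h.color hu
    have h6 := h.color_lt v
    refine ⟨j - 1, by omega, by omega, .inl (h.mxEquiv_of (by omega) (by omega) (by omega)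
      (fun i hi => hmin i (by omega)) fun i hi m hm hmv => ?_)⟩
    have h7 := h.in_le_out hac hu hvu hm hmv
    obtain rfl : i = j := by omega
    exact hjin m hm hmv

end IsLayering

theorem stmt_8 [Fintype V] (E : V → V → Prop) (A B : Set V)
    (hT : IsBipartiteTournament E A B) (M : Set V)
    (hcons : MConsistentOn E Set.univ M)
    (l : ℕ) (hl : 1 ≤ l) (X' X Y : ℕ → Set V)
    (hseq : IsMSeqOn E Set.univ M l X' X Y) (hX1A : X' 1 ⊆ A) :
    ((∀ v : V, ∃ i, 1 ≤ i ∧ i ≤ l ∧ (v ∈ X i ∨ v ∈ Y i)) ∧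
     (∀ i j, 1 ≤ i → i ≤ l → 1 ≤ j → j ≤ l → X i ∩ Y j = ∅) ∧
     (∀ i j, 1 ≤ i → i ≤ l → 1 ≤ j → j ≤ l → i ≠ j →
        X i ∩ X j = ∅ ∧ Y i ∩ Y j = ∅)) ∧
    (∀ i, 1 ≤ i → i ≤ l → X' i ⊆ X i) ∧
    (∀ i, 1 ≤ i → i ≤ l → Y i ∩ M = ∅) ∧
    (∀ i, 1 ≤ i → i ≤ l →
      (i % 2 = 1 → X i ⊆ A ∧ Y i ⊆ B) ∧ (i % 2 = 0 → X i ⊆ B ∧ Y i ⊆ A)) := by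
  classical
  obtain ⟨hcan, hX, hY, -⟩ := hseq
  have hL := hcan.isLayering hT hX1A
  have hac : ∀ v, AcyclicOn E (M ∪ {v}) := fun v => hcons v trivial
  have memX : ∀ {i v}, 1 ≤ i → i ≤ l → (v ∈ X i ↔ MXEquiv E M X' i v) := by
    intro i v h1 h2
    simp [hX i h1 h2]
  have memY : ∀ {i v}, 1 ≤ i → i ≤ l → (v ∈ Y i ↔ MXConflict E X' i v ∨
      (i = 1 ∧ MUnivMinus E M X' v) ∨ (i = l ∧ MUnivPlus E M X' v)) := by
    intro i v h1 h2
    rw [hY i h1 h2]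
    by_cases hi : i = 1 <;> by_cases hi' : i = l <;> simp [hi, hi', or_assoc]
  have hXcol : ∀ i v, 1 ≤ i → i ≤ l → v ∈ X i → (if v ∈ A then 1 else 0) = i % 2 :=
    fun i v h1 h2 hv => hL.color_of_mxEquiv ((memX h1 h2).1 hv)
  have hYcol : ∀ i v, 1 ≤ i → i ≤ l → v ∈ Y i → (if v ∈ A then 1 else 0) ≠ i % 2 := by
    intro i v h1 h2 hv
    rcases (memY h1 h2).1 hv with h | ⟨rfl, h⟩ | ⟨rfl, h⟩
    · exact hL.color_of_mxConflict h
    · exact hL.color_of_mUnivMinus hl h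
    · exact hL.color_of_mUnivPlus hl h
  have hYle : ∀ i j v, 1 ≤ i → i ≤ l → 1 ≤ j → j ≤ l → v ∈ Y i → v ∈ Y j → j ≤ i := by
    intro i j v hi hil hj hjl hvi hvj
    rcases (memY hi hil).1 hvi with h | ⟨h0, h⟩ | ⟨h0, h⟩ <;>
      rcases (memY hj hjl).1 hvj with h' | ⟨h0', h'⟩ | ⟨h0', h'⟩
    · exact h.index_le h'
    · exact absurd h (hL.not_mxConflict_of_mUnivMinus h')
    · exact absurd h (hL.not_mxConflict_of_mUnivPlus h')
    · exact absurd h' (hL.not_mxConflict_of_mUnivMinus h)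
    · omega
    · have := hL.eq_one_of_mUnivMinus_of_mUnivPlus hl h h'
      omega
    all_goals omega
  have hB : ∀ v, v ∉ A → v ∈ B := fun v hv => by
    have : v ∈ A ∪ B := by rw [hT.1]; trivial
    exact this.resolve_left hv
  refine ⟨⟨fun v => ?_, fun i j hi hil hj hjl => ?_, fun i j hi hil hj hjl hij => ⟨?_, ?_⟩⟩,
    fun i hi hil v hv => (memX hi hil).2 (MXEquiv.of_mem hv), fun i hi hil => ?_,
    fun i hi hil => ⟨fun hpar => ⟨fun v hv => ?_, fun v hv => ?_⟩,
      fun hpar => ⟨fun v hv => ?_, fun v hv => ?_⟩⟩⟩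
  · by_cases hin : ∃ m ∈ M, E m v
    · by_cases hout : ∃ m ∈ M, E v m
      · obtain ⟨i, hi, hil, h⟩ := hL.exists_mxEquiv_or_mxConflict (hac v) hin hout
        exact ⟨i, hi, hil, h.imp (memX hi hil).2 fun h => (memY hi hil).2 (.inl h)⟩
      · push Not at hout
        exact ⟨l, hl, le_rfl, (hL.mxEquiv_or_mUnivPlus hl (hac v) hout).imp (memX hl le_rfl).2
          fun h => (memY hl le_rfl).2 (.inr (.inr ⟨rfl, h⟩))⟩
    · push Not at hin
      exact ⟨1, le_rfl, hl, (hL.mxEquiv_or_mUnivMinus hl (hac v) hin).imp (memX le_rfl hl).2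
        fun h => (memY le_rfl hl).2 (.inr (.inl ⟨rfl, h⟩))⟩
  · refine Set.eq_empty_of_forall_notMem fun v ⟨hvX, hvY⟩ => ?_
    have hv := (memX hi hil).1 hvX
    rcases (memY hj hjl).1 hvY with h | ⟨-, h⟩ | ⟨-, h⟩
    exacts [hL.not_mxConflict_of_mxEquiv hv h, h.1 i hv, h.1 i hv]
  · exact Set.eq_empty_of_forall_notMem fun v ⟨hvi, hvj⟩ =>
      hij (hL.mxEquiv_index_unique ((memX hi hil).1 hvi) ((memX hj hjl).1 hvj))
  · exact Set.eq_empty_of_forall_notMem fun v ⟨hvi, hvj⟩ =>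
      hij (le_antisymm (hYle j i v hj hjl hi hil hvj hvi) (hYle i j v hi hil hj hjl hvi hvj))
  · refine Set.eq_empty_of_forall_notMem fun v ⟨hvY, hvM⟩ => ?_
    obtain ⟨j, hj⟩ := hL.exists_layer hvM
    have hv : MXEquiv E M X' j v := .of_mem hj
    rcases (memY hi hil).1 hvY with h | ⟨-, h⟩ | ⟨-, h⟩
    exacts [hL.not_mxConflict_of_mxEquiv hv h, h.1 j hv, h.1 j hv]
  · by_contra hA
    have := hXcol i v hi hil hv
    simp [hA, hpar] at this
  · refine hB v fun hA => ?_
    have := hYcol i v hi hil hv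
    simp [hA, hpar] at this
  · refine hB v fun hA => ?_
    have := hXcol i v hi hil hv
    simp [hA, hpar] at this
  · by_contra hA
    have := hYcol i v hi hil hv
    simp [hA, hpar] at this
end
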